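/- Let A, B ⊊ I be proper subsets with |A| + |B| ≥ k + 1, and suppose ℓ(u_B d_A) = |A| + |B| and D_R(u_B d_A) ⊆ {i} for some i ∈ I. Then u_B d_A = d_{A+1} u_{B+1}, where S + 1 = {s + 1 : s ∈ S} denotes the set obtained by adding 1 to each element of S ⊆ I. -/

import Mathlib

/-- `x : Equiv.Perm ℤ` is an affine permutation in `S̃_{k+1}`: it commutes with
translation by `k+1` and its window sums to `(k+1)(k+2)/2`. -/
def IsAffinePerm (k : ℕ) (x : Equiv.Perm ℤ) : Prop :=
  (∀ i : ℤ, x (i + (k + 1)) = x i + (k + 1)) ∧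
  ∑ i ∈ Finset.Icc (1 : ℤ) (k + 1), x i = (k + 1) * (k + 2) / 2

/-- The underlying function of the simple generator `s_i`. -/
def sAffFun (k : ℕ) (i : ZMod (k + 1)) (j : ℤ) : ℤ :=
  if (j : ZMod (k + 1)) = i then j + 1
  else if (j : ZMod (k + 1)) = i + 1 then j - 1
  else j

theorem sAffFun_invol (k : ℕ) (i : ZMod (k + 1)) (h : ¬ (1 : ZMod (k + 1)) = 0) :
    Function.Involutive (sAffFun k i) := by
  have hne : i + 1 ≠ i := fun hc => h (by
    have h2 : i + 1 = i + 0 := by simpa using hc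
    exact add_left_cancel h2)
  intro j
  by_cases h1 : (j : ZMod (k + 1)) = i
  · have e1 : sAffFun k i j = j + 1 := if_pos h1
    have hj1 : ((j + 1 : ℤ) : ZMod (k + 1)) = i + 1 := by push_cast; rw [h1]
    have e2 : sAffFun k i (j + 1) = j := by
      unfold sAffFun
      rw [if_neg (by rw [hj1]; exact hne), if_pos hj1]
      ring
    rw [e1, e2]
  · by_cases h2 : (j : ZMod (k + 1)) = i + 1
    · have e1 : sAffFun k i j = j - 1 := by unfold sAffFun; rw [if_neg h1, if_pos h2]
      have hj1 : ((j - 1 : ℤ) : ZMod (k + 1)) = i := by push_cast; rw [h2]; ring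
      have e2 : sAffFun k i (j - 1) = j := by
        unfold sAffFun; rw [if_pos hj1]; ring
      rw [e1, e2]
    · have e1 : sAffFun k i j = j := by unfold sAffFun; rw [if_neg h1, if_neg h2]
      rw [e1, e1]

/-- The simple generator `s_i` of the affine symmetric group, as a permutation of `ℤ`:
it interchanges `m(k+1) + ī` and `m(k+1) + ī + 1` for every `m` (when `k ≥ 1`). -/
noncomputable def sAff (k : ℕ) (i : ZMod (k + 1)) : Equiv.Perm ℤ :=
  if h : (1 : ZMod (k + 1)) = 0 then 1 else Function.Involutive.toPerm _ (sAffFun_invol k i h)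

/-- The Coxeter length of `x`: the least number of simple generators whose product is `x`. -/
noncomputable def affLen (k : ℕ) (x : Equiv.Perm ℤ) : ℕ :=
  sInf {n : ℕ | ∃ w : List (ZMod (k + 1)), w.length = n ∧ x = (w.map (sAff k)).prod}

/-- The right descent set `D_R(x) = {i : ℓ(x s_i) < ℓ(x)}`. -/
noncomputable def rightDescents (k : ℕ) (x : Equiv.Perm ℤ) : Set (ZMod (k + 1)) :=
  {i | affLen k (x * sAff k i) < affLen k x}

/-- The cyclic interval `[i,j] = {i, i+1, …, j}` of residues mod `k+1`. -/
def cycInt (k : ℕ) (i j : ZMod (k + 1)) : Finset (ZMod (k + 1)) :=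
  (Finset.range ((j - i).val + 1)).image fun t : ℕ => i + (t : ZMod (k + 1))

/-- A choice of a "gate" residue not belonging to `A` (when `A` is proper). -/
noncomputable def gate (k : ℕ) (A : Finset (ZMod (k + 1))) : ZMod (k + 1) :=
  if h : ∃ g, g ∉ A then h.choose else 0

/-- The cyclically decreasing element `d_A`: the product of the `s_a`, `a ∈ A`, in an
order where `s_{a+1}` occurs to the left of `s_a` whenever `a, a+1 ∈ A`. -/
noncomputable def dElt (k : ℕ) (A : Finset (ZMod (k + 1))) : Equiv.Perm ℤ :=
  (((((List.range (k + 1)).reverse.map fun t : ℕ => gate k A + (t : ZMod (k + 1))).filter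
      fun a => decide (a ∈ A)).map (sAff k)).prod)

/-- The cyclically increasing element `u_A`: the product of the `s_a`, `a ∈ A`, in an
order where `s_{a+1}` occurs to the right of `s_a` whenever `a, a+1 ∈ A`. -/
noncomputable def uElt (k : ℕ) (A : Finset (ZMod (k + 1))) : Equiv.Perm ℤ :=
  ((((List.range (k + 1)).map fun t : ℕ => gate k A + (t : ZMod (k + 1))).filter
      fun a => decide (a ∈ A)).map (sAff k)).prod

/-- The right decreasing code: `CRD(x)_i = #{j < ī : x(j) > x(ī)}`. -/
noncomputable def CRD (k : ℕ) (x : Equiv.Perm ℤ) (i : ZMod (k + 1)) : ℕ :=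
  Set.ncard {j : ℤ | j < (i.val : ℤ) ∧ x (i.val : ℤ) < x j}

/-- The right increasing code: `CRI(x)_i = #{j > ī + 1 : x(j) < x(ī + 1)}`. -/
noncomputable def CRI (k : ℕ) (x : Equiv.Perm ℤ) (i : ZMod (k + 1)) : ℕ :=
  Set.ncard {j : ℤ | (i.val : ℤ) + 1 < j ∧ x j < x ((i.val : ℤ) + 1)}

/-- The left decreasing code: `CLD(x)_i = #{j < x⁻¹(ī + 1) : x(j) > ī + 1}`. -/
noncomputable def CLD (k : ℕ) (x : Equiv.Perm ℤ) (i : ZMod (k + 1)) : ℕ :=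
  Set.ncard {j : ℤ | j < x.symm ((i.val : ℤ) + 1) ∧ (i.val : ℤ) + 1 < x j}

/-- The left increasing code: `CLI(x)_i = #{j > x⁻¹(ī) : x(j) < ī}`. -/
noncomputable def CLI (k : ℕ) (x : Equiv.Perm ℤ) (i : ZMod (k + 1)) : ℕ :=
  Set.ncard {j : ℤ | x.symm ((i.val : ℤ)) < j ∧ x j < (i.val : ℤ)}

/-- `d` acts on `ℤ` as the cyclically decreasing element of `A`: it lowers by one each `j` with
`j - 1 ∈ A`, and moves every other `j` to the first element at or above `j` outside `A`. -/
def IsCycDec (k : ℕ) (A : Finset (ZMod (k + 1))) (d : Equiv.Perm ℤ) : Prop :=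
  ∀ j : ℤ, ((j : ZMod (k + 1)) ∈ A → d (j + 1) = j) ∧
    ((j : ZMod (k + 1)) ∉ A → j + 1 ≤ d (j + 1) ∧ ((d (j + 1) : ℤ) : ZMod (k + 1)) ∉ A ∧
      ∀ t : ℤ, j + 1 ≤ t → t < d (j + 1) → (t : ZMod (k + 1)) ∈ A)

theorem zmod_one_ne_zero {k : ℕ} (hk : 1 ≤ k) : (1 : ZMod (k + 1)) ≠ 0 := by
  have : Fact (1 < k + 1) := ⟨by omega⟩
  exact one_ne_zero

theorem sAff_apply {k : ℕ} (hk : 1 ≤ k) (i : ZMod (k + 1)) (j : ℤ) :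
    sAff k i j = if (j : ZMod (k + 1)) = i then j + 1
      else if (j : ZMod (k + 1)) = i + 1 then j - 1 else j := by
  unfold sAff
  rw [dif_neg (zmod_one_ne_zero hk)]
  rfl

theorem sAff_apply_left {k : ℕ} (hk : 1 ≤ k) {i : ZMod (k + 1)} {j : ℤ}
    (h : (j : ZMod (k + 1)) = i) : sAff k i j = j + 1 := by
  rw [sAff_apply hk, if_pos h]

theorem sAff_apply_right {k : ℕ} (hk : 1 ≤ k) {i : ZMod (k + 1)} {j : ℤ}
    (h : (j : ZMod (k + 1)) = i + 1) : sAff k i j = j - 1 := by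
  have := zmod_one_ne_zero hk
  rw [sAff_apply hk, if_neg (by simpa [h] using this), if_pos h]

theorem sAff_apply_of_ne {k : ℕ} (hk : 1 ≤ k) {i : ZMod (k + 1)} {j : ℤ}
    (h : (j : ZMod (k + 1)) ≠ i) (h' : (j : ZMod (k + 1)) ≠ i + 1) : sAff k i j = j := by
  rw [sAff_apply hk, if_neg h, if_neg h']

theorem sAff_mul_self (k : ℕ) (i : ZMod (k + 1)) : sAff k i * sAff k i = 1 := by
  unfold sAff
  split_ifs with h
  · simp
  · ext j
    exact sAffFun_invol k i h j

theorem sAff_inv (k : ℕ) (i : ZMod (k + 1)) : (sAff k i)⁻¹ = sAff k i :=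
  inv_eq_of_mul_eq_one_left (sAff_mul_self k i)

/-- A permutation translating the residue classes of `c'` and `c' + 1` by `e` conjugates
`s_{c'}` to `s_{c' + e}`. -/
theorem sAff_mul_of_translates {k : ℕ} (hk : 1 ≤ k) {c c' : ZMod (k + 1)} {d : Equiv.Perm ℤ}
    (e : ℤ) (h : ∀ j : ℤ, (j : ZMod (k + 1)) = c' → d j = j + e)
    (h' : ∀ j : ℤ, (j : ZMod (k + 1)) = c' + 1 → d j = j + e)
    (hc : c = c' + e) : sAff k c * d = d * sAff k c' := by
  subst hc
  ext j
  simp only [Equiv.Perm.mul_apply]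
  by_cases h1 : (j : ZMod (k + 1)) = c'
  · rw [sAff_apply_left hk h1, h j h1, h' (j + 1) (by push_cast; rw [h1]),
      sAff_apply_left hk (by push_cast; rw [h1])]
    ring
  by_cases h2 : (j : ZMod (k + 1)) = c' + 1
  · rw [sAff_apply_right hk h2, h' j h2, h (j - 1) (by push_cast; rw [h2]; ring),
      sAff_apply_right hk (by push_cast; rw [h2]; ring)]
    ring
  rw [sAff_apply_of_ne hk h1 h2]
  apply sAff_apply_of_ne hk
  · intro h3
    have h4 : ((d j - e : ℤ) : ZMod (k + 1)) = c' := by push_cast; rw [h3]; ring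
    have h5 := d.injective ((h _ h4).trans (sub_add_cancel (d j) e))
    exact h1 (h5 ▸ h4)
  · intro h3
    have h4 : ((d j - e : ℤ) : ZMod (k + 1)) = c' + 1 := by push_cast; rw [h3]; ring
    have h5 := d.injective ((h' _ h4).trans (sub_add_cancel (d j) e))
    exact h2 (h5 ▸ h4)

theorem sAff_braid {k : ℕ} (hk : 1 ≤ k) (b : ZMod (k + 1)) (hb : b + 1 + 1 ≠ b) :
    sAff k b * sAff k (b + 1) * sAff k b = sAff k (b + 1) * (sAff k b * sAff k (b + 1)) := by
  have h1 := zmod_one_ne_zero hk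
  refine (sAff_mul_of_translates hk 1 (fun j hj => ?_) (fun j hj => ?_) (by simp)).symm
  · rw [Equiv.Perm.mul_apply, sAff_apply_of_ne hk (j := j) (by simpa [hj] using h1)
      (by rw [hj]; exact hb.symm), sAff_apply_left hk hj]
  · rw [Equiv.Perm.mul_apply, sAff_apply_left hk hj, sAff_apply_of_ne hk
      (by push_cast; rw [hj]; exact hb) (by push_cast; rw [hj]; simpa using h1)]

namespace IsCycDec

variable {k : ℕ} {A B : Finset (ZMod (k + 1))} {d e : Equiv.Perm ℤ}

theorem unique (h : IsCycDec k A d) (h' : IsCycDec k A e) : d = e := by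
  ext j
  obtain ⟨a1, a2⟩ := h (j - 1)
  obtain ⟨b1, b2⟩ := h' (j - 1)
  rw [sub_add_cancel] at *
  by_cases hj : ((j - 1 : ℤ) : ZMod (k + 1)) ∈ A
  · rw [a1 hj, b1 hj]
  · obtain ⟨p1, p2, p3⟩ := a2 hj
    obtain ⟨q1, q2, q3⟩ := b2 hj
    rcases lt_trichotomy (d j) (e j) with hlt | heq | hlt
    · exact absurd (q3 _ p1 hlt) p2
    · exact heq
    · exact absurd (p3 _ q1 hlt) q2

theorem apply_of_notMem (h : IsCycDec k A d) {j : ℤ} (h1 : ((j - 1 : ℤ) : ZMod (k + 1)) ∉ A)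
    (h2 : (j : ZMod (k + 1)) ∉ A) : d j = j := by
  obtain ⟨p1, -, p3⟩ := (h (j - 1)).2 h1
  rw [sub_add_cancel] at *
  by_contra hne
  exact h2 (p3 j le_rfl (by omega))

theorem sAff_mul (hk : 1 ≤ k) (h : IsCycDec k A d) {a : ZMod (k + 1)} (ha : a ∉ A)
    (ha' : a + 1 ∉ A) : IsCycDec k (insert a A) (sAff k a * d) := by
  have hone := zmod_one_ne_zero hk
  intro j
  rw [Equiv.Perm.mul_apply]
  refine ⟨fun hj => ?_, fun hj => ?_⟩
  · by_cases hja : (j : ZMod (k + 1)) = a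
    · rw [h.apply_of_notMem (by simpa [hja] using ha) (by simpa [hja] using ha'),
        sAff_apply_right hk (by simp [hja])]
      ring
    · have hjA : (j : ZMod (k + 1)) ∈ A := (Finset.mem_insert.1 hj).resolve_left hja
      rw [(h j).1 hjA, sAff_apply_of_ne hk hja (fun hc => ha' (hc ▸ hjA))]
  · obtain ⟨hja, hjA⟩ : (j : ZMod (k + 1)) ≠ a ∧ (j : ZMod (k + 1)) ∉ A := by
      simpa using hj
    obtain ⟨p1, p2, p3⟩ := (h j).2 hjA
    generalize d (j + 1) = p at p1 p2 p3
    by_cases hpa : (p : ZMod (k + 1)) = a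
    · rw [sAff_apply_left hk hpa]
      refine ⟨by omega, by simp [hpa, hone, ha'], fun t h1 h2 => ?_⟩
      rcases (Int.lt_add_one_iff.1 h2).lt_or_eq with h3 | h3
      · exact Finset.mem_insert_of_mem (p3 t h1 h3)
      · simp [h3, hpa]
    · have hpa' : (p : ZMod (k + 1)) ≠ a + 1 := by
        intro hc
        have hc' : ((p - 1 : ℤ) : ZMod (k + 1)) = a := by simp [hc]
        rcases p1.lt_or_eq with h1 | h1
        · exact ha (hc' ▸ p3 (p - 1) (by omega) (by omega))
        · apply hja
          rw [← hc', ← h1]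
          simp
      rw [sAff_apply_of_ne hk hpa hpa']
      exact ⟨p1, by simp [hpa, p2], fun t h1 h2 => Finset.mem_insert_of_mem (p3 t h1 h2)⟩

theorem mul_sAff (hk : 1 ≤ k) (h : IsCycDec k A d) {a : ZMod (k + 1)} (ha : a ∉ A)
    (ha' : a - 1 ∉ A) : IsCycDec k (insert a A) (d * sAff k a) := by
  have hone := zmod_one_ne_zero hk
  intro j
  rw [Equiv.Perm.mul_apply]
  by_cases hja : (j : ZMod (k + 1)) = a
  · rw [sAff_apply_right hk (by simp [hja]), add_sub_cancel_right,
      h.apply_of_notMem (by simpa [hja] using ha') (by simpa [hja] using ha)]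
    simp [hja]
  by_cases hja' : (j : ZMod (k + 1)) = a - 1
  · rw [sAff_apply_left hk (by simp [hja'])]
    have hj1 : ((j + 1 : ℤ) : ZMod (k + 1)) = a := by simp [hja']
    refine ⟨fun hj => ?_, fun hj => ?_⟩
    · simp [hja', ha', hone] at hj
    · obtain ⟨p1, p2, p3⟩ := (h (j + 1)).2 (by rw [hj1]; exact ha)
      refine ⟨by omega, ?_, fun t h1 h2 => ?_⟩
      · intro hc
        rcases Finset.mem_insert.1 hc with hc | hc
        · have h6 : ((d (j + 1 + 1) : ℤ) : ZMod (k + 1)) = a := hc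
          have h7 : d (d (j + 1 + 1)) = d (j + 1 + 1) := by
            refine h.apply_of_notMem ?_ (by rw [h6]; exact ha)
            push_cast
            rw [h6]
            exact ha'
          have h8 := d.injective h7
          rw [h8] at h6
          push_cast at h6 hj1
          rw [hj1] at h6
          simp [hone] at h6
        · exact p2 hc
      · rcases h1.lt_or_eq with h3 | h3
        · exact Finset.mem_insert_of_mem (p3 t (by omega) h2)
        · rw [← h3, hj1]
          exact Finset.mem_insert_self _ _
  · rw [sAff_apply_of_ne hk (i := a) (j := j + 1)
      (fun hc => hja' (by rw [← hc]; simp)) (fun hc => hja (by simpa using hc))]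
    refine ⟨fun hj => (h j).1 ((Finset.mem_insert.1 hj).resolve_left hja), fun hj => ?_⟩
    obtain ⟨p1, p2, p3⟩ := (h j).2 (fun hc => hj (Finset.mem_insert_of_mem hc))
    refine ⟨p1, ?_, fun t h1 h2 => Finset.mem_insert_of_mem (p3 t h1 h2)⟩
    intro hc
    rcases Finset.mem_insert.1 hc with hc | hc
    · have h7 : d (d (j + 1)) = d (j + 1) := by
        refine h.apply_of_notMem ?_ (by rw [hc]; exact ha)
        push_cast
        rw [hc]
        exact ha'
      have h8 := d.injective h7
      rw [h8] at hc
      exact hja' (by rw [← hc]; simp)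
    · exact p2 hc

theorem list_prod (hk : 1 ≤ k) (l : List (ZMod (k + 1)))
    (hl : l.Pairwise fun a b => b ≠ a ∧ b ≠ a + 1) :
    IsCycDec k l.toFinset (l.map (sAff k)).prod := by
  induction l with
  | nil =>
    intro j
    simp only [List.toFinset_nil, Finset.notMem_empty, List.map_nil, List.prod_nil,
      Equiv.Perm.one_apply]
    exact ⟨fun h => h.elim, fun _ => ⟨le_rfl, id, fun t h1 h2 => by omega⟩⟩
  | cons a l ih =>
    obtain ⟨h1, h2⟩ := List.pairwise_cons.1 hl
    rw [List.toFinset_cons, List.map_cons, List.prod_cons]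
    exact (ih h2).sAff_mul hk (fun hc => (h1 a (List.mem_toFinset.1 hc)).1 rfl)
      (fun hc => (h1 _ (List.mem_toFinset.1 hc)).2 rfl)

theorem image_add_one (h : IsCycDec k A d) :
    IsCycDec k (A.image fun a => a + 1)
      ((Equiv.addRight 1 : Equiv.Perm ℤ) * d * (Equiv.addRight 1 : Equiv.Perm ℤ)⁻¹) := by
  have hmem : ∀ t : ℤ, (t : ZMod (k + 1)) ∈ A.image (fun a => a + 1) ↔
      ((t - 1 : ℤ) : ZMod (k + 1)) ∈ A := by
    intro t
    simp only [Finset.mem_image, Int.cast_sub, Int.cast_one]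
    exact ⟨by rintro ⟨a, ha, hat⟩; rw [← hat]; simpa using ha, fun ht => ⟨_, ht, by simp⟩⟩
  intro j
  have hj : ((Equiv.addRight 1 : Equiv.Perm ℤ) * d * (Equiv.addRight 1 : Equiv.Perm ℤ)⁻¹)
      (j + 1) = d j + 1 := by
    simp [Equiv.Perm.mul_apply, Equiv.Perm.inv_def]
  obtain ⟨h1, h2⟩ := h (j - 1)
  rw [sub_add_cancel] at h1 h2
  rw [hj, hmem, hmem, add_sub_cancel_right]
  refine ⟨fun hjA => by rw [h1 hjA]; ring, fun hjA => ?_⟩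
  obtain ⟨p1, p2, p3⟩ := h2 hjA
  refine ⟨by omega, p2, fun t ht1 ht2 => (hmem t).2 (p3 _ (by omega) (by omega))⟩

/-- If `A` and `B` cover all residues, their cyclically decreasing permutations commute up to
the translation by one. -/
theorem apply_apply_add_one (hd : IsCycDec k A d) (he : IsCycDec k B e)
    (hAB : ∀ a, a ∈ A ∨ a ∈ B) (j : ℤ) : d (e (j + 1) + 1) = e (d (j + 1) + 1) := by
  by_cases hA : (j : ZMod (k + 1)) ∈ A <;> by_cases hB : (j : ZMod (k + 1)) ∈ B
  · rw [(hd j).1 hA, (he j).1 hB, (hd j).1 hA]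
  · rw [(hd j).1 hA]
    exact (hd _).1 ((hAB _).resolve_right ((he j).2 hB).2.1)
  · rw [(he j).1 hB]
    exact ((he _).1 ((hAB _).resolve_left ((hd j).2 hA).2.1)).symm
  · exact absurd (hAB j) (by simp [hA, hB])

end IsCycDec

section Words

variable {k : ℕ} {A B : Finset (ZMod (k + 1))}

theorem gate_notMem (hA : A ≠ Finset.univ) : gate k A ∉ A := by
  have h : ∃ g, g ∉ A := by
    by_contra! hc
    exact hA (Finset.eq_univ_iff_forall.2 hc)
  unfold gate
  rw [dif_pos h]
  exact h.choose_spec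

theorem eq_of_natCast_zmod_eq {k s t : ℕ} (hs : s < k + 1) (ht : t < k + 1)
    (h : (s : ZMod (k + 1)) = t) : s = t := by
  rw [ZMod.natCast_eq_natCast_iff'] at h
  rwa [Nat.mod_eq_of_lt hs, Nat.mod_eq_of_lt ht] at h

/-- The word defining the cyclically decreasing element of `A`. -/
noncomputable def cycDecWord (k : ℕ) (A : Finset (ZMod (k + 1))) : List (ZMod (k + 1)) :=
  ((List.range (k + 1)).reverse.map fun t : ℕ => gate k A + (t : ZMod (k + 1))).filter
    fun a => decide (a ∈ A)

theorem cycDecWord_toFinset : (cycDecWord k A).toFinset = A := by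
  ext a
  simp only [cycDecWord, List.mem_toFinset, List.mem_filter, List.mem_map, List.mem_reverse,
    List.mem_range, decide_eq_true_eq, and_iff_right_iff_imp]
  intro _
  exact ⟨(a - gate k A).val, ZMod.val_lt _, by simp⟩

theorem cycDecWord_pairwise (hA : A ≠ Finset.univ) :
    (cycDecWord k A).Pairwise fun a b => b ≠ a ∧ b ≠ a + 1 := by
  rw [cycDecWord, List.pairwise_filter, List.pairwise_map, List.pairwise_reverse]
  refine List.pairwise_lt_range.imp_of_mem fun {s t} hs ht hst ha hb => ?_
  rw [List.mem_range] at hs ht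
  refine ⟨fun hc => ?_, fun hc => ?_⟩
  · exact hst.ne (eq_of_natCast_zmod_eq hs ht (add_left_cancel hc))
  · rw [add_assoc] at hc
    have hc' : (s : ZMod (k + 1)) = ((t + 1 : ℕ) : ZMod (k + 1)) := by
      push_cast
      exact add_left_cancel hc
    rcases Nat.lt_or_ge (t + 1) (k + 1) with h | h
    · have := eq_of_natCast_zmod_eq hs h hc'
      omega
    · have h0 : t + 1 = k + 1 := by omega
      rw [h0, ZMod.natCast_self] at hc'
      rw [hc', add_zero] at hb
      exact gate_notMem hA (by simpa using hb)

theorem cycDecWord_length (hA : A ≠ Finset.univ) : (cycDecWord k A).length = A.card := by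
  conv_rhs => rw [← cycDecWord_toFinset (A := A)]
  exact (List.toFinset_card_of_nodup ((cycDecWord_pairwise hA).imp fun h => h.1.symm)).symm

theorem dElt_eq_prod : dElt k A = ((cycDecWord k A).map (sAff k)).prod := rfl

theorem isCycDec_dElt (hk : 1 ≤ k) (hA : A ≠ Finset.univ) : IsCycDec k A (dElt k A) := by
  have h := IsCycDec.list_prod hk _ (cycDecWord_pairwise hA)
  rwa [cycDecWord_toFinset] at h

theorem sAff_prod_inv (w : List (ZMod (k + 1))) :
    ((w.map (sAff k)).prod)⁻¹ = (w.reverse.map (sAff k)).prod := by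
  have h : Inv.inv ∘ sAff k = sAff k := funext (sAff_inv k)
  rw [List.prod_inv_reverse, List.map_map, h, List.map_reverse]

theorem uElt_eq_inv : uElt k A = (dElt k A)⁻¹ := by
  rw [dElt_eq_prod, sAff_prod_inv, uElt, cycDecWord, ← List.filter_reverse, ← List.map_reverse,
    List.reverse_reverse]

/-- `x` is a product of at most `m` simple generators. -/
def IsShortProd (k m : ℕ) (x : Equiv.Perm ℤ) : Prop :=
  ∃ w : List (ZMod (k + 1)), w.length ≤ m ∧ x = (w.map (sAff k)).prod

theorem IsShortProd.affLen_le {m : ℕ} {x : Equiv.Perm ℤ} (h : IsShortProd k m x) :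
    affLen k x ≤ m := by
  obtain ⟨w, hw, hx⟩ := h
  have h : affLen k x ≤ w.length := Nat.sInf_le ⟨w, rfl, hx⟩
  exact h.trans hw

theorem IsShortProd.mul {m n : ℕ} {x y : Equiv.Perm ℤ} (hx : IsShortProd k m x)
    (hy : IsShortProd k n y) : IsShortProd k (m + n) (x * y) := by
  obtain ⟨v, hv, rfl⟩ := hx
  obtain ⟨w, hw, rfl⟩ := hy
  exact ⟨v ++ w, by rw [List.length_append]; omega, by simp⟩

theorem IsShortProd.inv {m : ℕ} {x : Equiv.Perm ℤ} (hx : IsShortProd k m x) :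
    IsShortProd k m x⁻¹ := by
  obtain ⟨w, hw, rfl⟩ := hx
  exact ⟨w.reverse, by simpa using hw, sAff_prod_inv w⟩

theorem isShortProd_sAff (i : ZMod (k + 1)) : IsShortProd k 1 (sAff k i) :=
  ⟨[i], by simp, by simp⟩

theorem isShortProd_dElt (hA : A ≠ Finset.univ) : IsShortProd k A.card (dElt k A) :=
  ⟨_, (cycDecWord_length hA).le, dElt_eq_prod⟩

theorem isShortProd_uElt (hA : A ≠ Finset.univ) : IsShortProd k A.card (uElt k A) :=
  uElt_eq_inv (A := A) ▸ (isShortProd_dElt hA).inv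

theorem erase_ne_univ (a : ZMod (k + 1)) : A.erase a ≠ Finset.univ :=
  fun h => Finset.notMem_erase a A (h ▸ Finset.mem_univ a)

theorem dElt_eq_sAff_mul (hk : 1 ≤ k) (hA : A ≠ Finset.univ) {a : ZMod (k + 1)} (ha : a ∈ A)
    (ha' : a + 1 ∉ A) : dElt k A = sAff k a * dElt k (A.erase a) := by
  have h := (isCycDec_dElt hk (erase_ne_univ (A := A) a)).sAff_mul hk
    (Finset.notMem_erase a A) (fun hc => ha' (Finset.mem_of_mem_erase hc))
  rw [Finset.insert_erase ha] at h
  exact (isCycDec_dElt hk hA).unique h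

theorem dElt_eq_mul_sAff (hk : 1 ≤ k) (hA : A ≠ Finset.univ) {a : ZMod (k + 1)} (ha : a ∈ A)
    (ha' : a - 1 ∉ A) : dElt k A = dElt k (A.erase a) * sAff k a := by
  have h := (isCycDec_dElt hk (erase_ne_univ (A := A) a)).mul_sAff hk
    (Finset.notMem_erase a A) (fun hc => ha' (Finset.mem_of_mem_erase hc))
  rw [Finset.insert_erase ha] at h
  exact (isCycDec_dElt hk hA).unique h

theorem uElt_eq_mul_sAff (hk : 1 ≤ k) (hA : A ≠ Finset.univ) {a : ZMod (k + 1)} (ha : a ∈ A)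
    (ha' : a + 1 ∉ A) : uElt k A = uElt k (A.erase a) * sAff k a := by
  rw [uElt_eq_inv, uElt_eq_inv, dElt_eq_sAff_mul hk hA ha ha', mul_inv_rev, sAff_inv]

theorem sAff_mul_dElt_of_mem (hk : 1 ≤ k) (hA : A ≠ Finset.univ) {b : ZMod (k + 1)} (hb : b ∈ A)
    (hb' : b + 1 ∈ A) : sAff k b * dElt k A = dElt k A * sAff k (b + 1) := by
  have h := isCycDec_dElt hk hA
  refine sAff_mul_of_translates hk (-1) (fun j hj => ?_) (fun j hj => ?_) (by simp)
  all_goals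
    have h1 := (h (j - 1)).1 (by simpa [hj])
    rw [sub_add_cancel] at h1
    rw [h1]
    ring

theorem sAff_mul_dElt_of_notMem (hk : 1 ≤ k) (hA : A ≠ Finset.univ) {c : ZMod (k + 1)}
    (h0 : c - 1 ∉ A) (h1 : c ∉ A) (h2 : c + 1 ∉ A) :
    sAff k c * dElt k A = dElt k A * sAff k c := by
  have h := isCycDec_dElt hk hA
  refine sAff_mul_of_translates hk 0 (fun j hj => ?_) (fun j hj => ?_) (by simp)
  · rw [h.apply_of_notMem (by simpa [hj] using h0) (by simpa [hj] using h1), add_zero]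
  · rw [h.apply_of_notMem (by simpa [hj] using h1) (by simpa [hj] using h2), add_zero]

theorem uElt_mul_dElt_of_cover (hk : 1 ≤ k) (hA : A ≠ Finset.univ) (hB : B ≠ Finset.univ)
    (hAB : ∀ a, a ∈ A ∨ a ∈ B) :
    uElt k B * dElt k A =
      dElt k (A.image fun a => a + 1) * uElt k (B.image fun a => a + 1) := by
  have himage : ∀ C : Finset (ZMod (k + 1)), C ≠ Finset.univ →
      C.image (fun a => a + 1) ≠ Finset.univ := by
    intro C hC h
    apply hC
    rw [← Finset.card_eq_iff_eq_univ] at h ⊢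
    rwa [Finset.card_image_of_injective _ (add_left_injective 1)] at h
  have hd := isCycDec_dElt hk hA
  have he := isCycDec_dElt hk hB
  rw [uElt_eq_inv, uElt_eq_inv, eq_mul_inv_iff_mul_eq, mul_assoc, inv_mul_eq_iff_eq_mul,
    (isCycDec_dElt hk (himage A hA)).unique hd.image_add_one,
    (isCycDec_dElt hk (himage B hB)).unique he.image_add_one]
  ext j
  have h := hd.apply_apply_add_one he hAB (j - 2)
  rw [show j - 2 + 1 = j - 1 by ring] at h
  simpa [Equiv.Perm.mul_apply, Equiv.Perm.inv_def, ← sub_eq_add_neg] using h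

/-- A property of residues that holds at `b` but not everywhere holds along a maximal run
`b, b + 1, …, b + m` and fails at `b + m + 1`. -/
theorem exists_run_end {P : ZMod (k + 1) → Prop} {b g : ZMod (k + 1)} (hb : P b) (hg : ¬ P g) :
    ∃ m : ℕ, (∀ t ≤ m, P (b + t)) ∧ ¬ P (b + m + 1) := by
  classical
  have hex : ∃ m : ℕ, ¬ P (b + m) := ⟨(g - b).val, by simpa using hg⟩
  have hpos : Nat.find hex ≠ 0 := by
    intro h0
    have := Nat.find_spec hex
    rw [h0] at this
    simp [hb] at this
  obtain ⟨m, hm⟩ := Nat.exists_eq_succ_of_ne_zero hpos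
  refine ⟨m, fun t ht => ?_, ?_⟩
  · by_contra hc
    exact Nat.find_min hex (by omega) hc
  · have := Nat.find_spec hex
    rw [hm] at this
    push_cast at this
    rwa [add_assoc]

/-- Local conditions on `A` and `B` that force them to cover all residues. -/
theorem cover_of_local (hB : B ≠ Finset.univ)
    (hsize : k + 1 ≤ A.card + B.card) {i : ZMod (k + 1)}
    (hstart : ∀ a ∈ A, a - 1 ∉ A → a = i)
    (hstep : ∀ b ∈ A, b ∈ B → b + 1 ∈ B)
    (hend : ∀ c ∈ B, c ∉ A → c + 1 ∉ A → c + 1 ∉ B → c - 1 ∉ B) :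
    ∀ a, a ∈ A ∨ a ∈ B := by
  by_cases hdisj : Disjoint A B
  · have : (A ∪ B) = Finset.univ := by
      refine (Finset.card_eq_iff_eq_univ _).1 (le_antisymm (Finset.card_le_univ _) ?_)
      rw [Finset.card_union_of_disjoint hdisj, ZMod.card]
      exact hsize
    intro a
    exact Finset.mem_union.1 (this ▸ Finset.mem_univ a)
  obtain ⟨b, hbA, hbB⟩ := Finset.not_disjoint_iff.1 hdisj
  obtain ⟨m, hm, hm'⟩ := exists_run_end (P := (· ∈ B)) hbB (gate_notMem hB)
  have hmA : b + m ∉ A := fun hc => hm' (hstep _ hc (hm m le_rfl))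
  have hi : b + m + 1 = i := by
    refine hstart _ ?_ (by simpa using hmA)
    by_contra hc
    have h1 := hend _ (hm m le_rfl) hmA hc hm'
    rcases m with _ | m
    · simp [hbA] at hmA
    · apply h1
      have := hm m (by omega)
      convert this using 1
      push_cast
      ring
  intro y
  by_contra! hy
  obtain ⟨t, ht, ht'⟩ := exists_run_end (P := (· ∉ A)) hy.1 (g := b) (by simpa using hbA)
  have hti : y + t + 1 = i := hstart _ (by simpa using ht') (by simpa using ht t le_rfl)
  have hyb : y + t = b + m := by
    rw [← hi] at hti
    exact add_right_cancel hti
  rcases Nat.lt_or_ge t m with h | h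
  · apply hy.2
    have h2 := hm (m - t) (by omega)
    rw [Nat.cast_sub h.le, ← add_sub_assoc, ← hyb, add_sub_cancel_right] at h2
    exact h2
  · have h2 := ht (t - m) (by omega)
    rw [Nat.cast_sub h, ← add_sub_assoc, hyb, add_sub_cancel_right] at h2
    exact h2 hbA

end Words

/-- for `|A| + |B| ≥ k + 1` with `u_B d_A` reduced and `i`-dominant,
`u_B d_A = d_{A+1} u_{B+1}`. -/
theorem up_down_shift (k : ℕ) (hk : 1 ≤ k) (A B : Finset (ZMod (k + 1)))
    (hA : A ≠ Finset.univ) (hB : B ≠ Finset.univ)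
    (hsize : k + 1 ≤ A.card + B.card) (i : ZMod (k + 1))
    (hred : affLen k (uElt k B * dElt k A) = A.card + B.card)
    (hdom : rightDescents k (uElt k B * dElt k A) ⊆ {i}) :
    uElt k B * dElt k A =
      dElt k (A.image (fun a => a + 1)) * uElt k (B.image (fun a => a + 1)) := by
  have hdesc : ∀ (m : ℕ) (c : ZMod (k + 1)) (y : Equiv.Perm ℤ), IsShortProd k m y →
      m < A.card + B.card → uElt k B * dElt k A = y * sAff k c → c = i := by
    intro m c y hy hm heq
    refine hdom (show affLen k _ < affLen k _ from ?_)
    rw [hred, heq, mul_assoc, sAff_mul_self, mul_one]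
    exact hy.affLen_le.trans_lt hm
  have hcard : ∀ {C : Finset (ZMod (k + 1))} {a}, a ∈ C → (C.erase a).card + 1 = C.card :=
    fun h => Finset.card_erase_add_one h
  have hstart : ∀ a ∈ A, a - 1 ∉ A → a = i := by
    intro a ha ha'
    refine hdesc _ a _ ((isShortProd_uElt hB).mul (isShortProd_dElt (erase_ne_univ (A := A) a)))
      ?_ ?_
    · have := hcard ha
      omega
    · rw [dElt_eq_mul_sAff hk hA ha ha', mul_assoc]
  have hAne : A.Nonempty := by
    rw [← Finset.card_pos]
    have := Finset.card_lt_univ_of_notMem (gate_notMem hB)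
    rw [ZMod.card] at this
    omega
  have hi : i ∈ A ∧ i - 1 ∉ A := by
    obtain ⟨a, ha⟩ := hAne
    obtain ⟨m, hm, hm'⟩ := exists_run_end (P := (· ∉ A)) (gate_notMem hA) (g := a) (by simpa)
    have hend : gate k A + m + 1 ∈ A := by simpa using hm'
    have hpred : gate k A + m + 1 - 1 ∉ A := by simpa using hm m le_rfl
    exact hstart _ hend hpred ▸ ⟨hend, hpred⟩
  refine uElt_mul_dElt_of_cover hk hA hB (cover_of_local hB hsize hstart ?_ ?_)
  · intro b hbA hbB
    by_contra hb
    have hBb := hcard hbB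
    by_cases hbA' : b + 1 ∈ A
    · have hbi : b + 1 = i := by
        refine hdesc _ _ _
          ((isShortProd_uElt (erase_ne_univ (A := B) b)).mul (isShortProd_dElt hA)) (by omega) ?_
        rw [uElt_eq_mul_sAff hk hB hbB hb, mul_assoc, sAff_mul_dElt_of_mem hk hA hbA hbA',
          mul_assoc]
      exact hi.2 (by rw [← hbi]; simpa using hbA)
    · have hAb := hcard hbA
      have h := ((isShortProd_uElt (erase_ne_univ (A := B) b)).mul
        (isShortProd_dElt (erase_ne_univ (A := A) b))).affLen_le
      have heq : uElt k B * dElt k A = uElt k (B.erase b) * dElt k (A.erase b) := by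
        rw [uElt_eq_mul_sAff hk hB hbB hb, dElt_eq_sAff_mul hk hA hbA hbA', mul_assoc,
          ← mul_assoc (sAff k b), sAff_mul_self, one_mul]
      rw [← heq, hred] at h
      omega
  · intro c hcB hcA hcA' hcB' hpB
    have hBc := hcard hcB
    have hone := zmod_one_ne_zero hk
    suffices h : c = i from hcA (h ▸ hi.1)
    by_cases hpA : c - 1 ∈ A
    · obtain ⟨b, rfl⟩ : ∃ b, c = b + 1 := ⟨c - 1, by ring⟩
      rw [add_sub_cancel_right] at hpA hpB
      have hbB : b ∈ B.erase (b + 1) := Finset.mem_erase.2 ⟨by simpa using hone, hpB⟩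
      have hBb := hcard hbB
      refine hdesc _ _ _ (((isShortProd_uElt (erase_ne_univ (A := B.erase (b + 1)) b)).mul
        (isShortProd_sAff (b + 1))).mul (isShortProd_dElt hA)) (by omega) ?_
      have hcomm : sAff k (b + 1) * dElt k (A.erase b) = dElt k (A.erase b) * sAff k (b + 1) :=
        sAff_mul_dElt_of_notMem hk (erase_ne_univ b) (by simp)
          (fun h => hcA (Finset.mem_of_mem_erase h)) (fun h => hcA' (Finset.mem_of_mem_erase h))
      rw [uElt_eq_mul_sAff hk hB hcB hcB', uElt_eq_mul_sAff hk (erase_ne_univ _) hbB (by simp),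
        dElt_eq_sAff_mul hk hA hpA hcA]
      have hbraid := sAff_braid hk b (fun h => hcA' (by rw [h]; exact hpA))
      simp only [mul_assoc] at hbraid ⊢
      rw [← hcomm]
      congr 1
      simpa only [mul_assoc] using congrArg (· * dElt k (A.erase b)) hbraid
    · refine hdesc _ _ _
        ((isShortProd_uElt (erase_ne_univ (A := B) c)).mul (isShortProd_dElt hA)) (by omega) ?_
      rw [uElt_eq_mul_sAff hk hB hcB hcB', mul_assoc, sAff_mul_dElt_of_notMem hk hA hpA hcA hcA',
        mul_assoc]
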